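/- arXiv:math/0001017 — 2 statements merged into one kernel-verified Lean document; each statement's English description precedes it below -/
import Mathlib

section
/- Let τ be an infinite cardinal and let A be a directed partially ordered set that is τ-complete. Let {A_t : t ∈ T} be a family of subsets of A, each of which is cofinal and τ-closed in A, with |T| ≤ τ. Then the intersection ⋂{A_t : t ∈ T} is cofinal in A (in particular, nonempty) and τ-closed in A. -/
universe u

/-- In a directed partial order in which nonempty chains of cardinality at most `τ` have suprema,
every family of at most `τ` elements is bounded above. -/
theorem exists_forall_le_of_chain_complete {A : Type u} [PartialOrder A] [Nonempty A]
    (τ : Cardinal.{u}) (hdir : ∀ a b : A, ∃ c : A, a ≤ c ∧ b ≤ c)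
    (hcomplete : ∀ C : Set A, C.Nonempty → IsChain (· ≤ ·) C →
      Cardinal.mk C ≤ τ → ∃ s : A, IsLUB C s)
    {T : Type u} (hT : Cardinal.mk T ≤ τ) (f : T → A) : ∃ u, ∀ t, f t ≤ u := by
  classical
  obtain ⟨_, hwf⟩ := exists_wellFoundedLT T
  have bdd : ∀ (g : T → A) (S : Set T), (∀ t ∈ S, ∀ s < t, g s ≤ g t) →
      ∃ u, ∀ s ∈ S, g s ≤ u := by
    intro g S hg
    rcases S.eq_empty_or_nonempty with rfl | hS
    · exact ⟨Classical.arbitrary A, by simp⟩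
    · have hchain : IsChain (· ≤ ·) (g '' S) := by
        rintro _ ⟨s, hs, rfl⟩ _ ⟨t, ht, rfl⟩ hne
        rcases lt_trichotomy s t with h | h | h
        · exact Or.inl (hg t ht s h)
        · exact absurd (congrArg g h) hne
        · exact Or.inr (hg s hs t h)
      obtain ⟨u, hu⟩ := hcomplete (g '' S) (hS.image g) hchain
        ((Cardinal.mk_image_le.trans (Cardinal.mk_set_le S)).trans hT)
      exact ⟨u, fun s hs => hu.1 ⟨s, hs, rfl⟩⟩
  let F : (t : T) → ((s : T) → s < t → A) → A := fun t ih =>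
    Classical.epsilon fun u => f t ≤ u ∧ ∀ s (h : s < t), ih s h ≤ u
  let g : T → A := hwf.wf.fix F
  have hg : ∀ t, g t = Classical.epsilon fun u => f t ≤ u ∧ ∀ s < t, g s ≤ u :=
    fun t => hwf.wf.fix_eq F t
  have key : ∀ t, f t ≤ g t ∧ ∀ s < t, g s ≤ g t := by
    intro t
    induction t using hwf.wf.induction with
    | _ t ih =>
      obtain ⟨v, hv⟩ := bdd g (Set.Iio t) fun s hs => (ih s hs).2
      obtain ⟨w, hfw, hvw⟩ := hdir (f t) v
      have hex : ∃ u, f t ≤ u ∧ ∀ s < t, g s ≤ u :=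
        ⟨w, hfw, fun s hs => (hv s hs).trans hvw⟩
      rw [hg t]
      exact Classical.epsilon_spec hex
  obtain ⟨u, hu⟩ := bdd g Set.univ fun t _ => (key t).2
  exact ⟨u, fun t => (key t).1.trans (hu t trivial)⟩

/-- Let `τ` be an infinite cardinal and `A` a directed partially ordered
set that is `τ`-complete.  If `{A_t : t ∈ T}` is a family of cofinal, `τ`-closed subsets
of `A` with `|T| ≤ τ`, then `⋂ t, A_t` is cofinal (in particular nonempty) and `τ`-closed
in `A`. -/
theorem statement0 {A : Type u} [PartialOrder A] (τ : Cardinal.{u})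
    (hτ : Cardinal.aleph0 ≤ τ)
    -- `A` is directed
    (hdir : ∀ a b : A, ∃ c : A, a ≤ c ∧ b ≤ c)
    -- `A` is `τ`-complete: every nonempty chain of cardinality `≤ τ` has a supremum
    (hcomplete : ∀ C : Set A, C.Nonempty → IsChain (· ≤ ·) C →
      Cardinal.mk C ≤ τ → ∃ s : A, IsLUB C s)
    {T : Type u} (hT : Cardinal.mk T ≤ τ) (At : T → Set A)
    -- each `At t` is cofinal in `A`
    (hcof : ∀ t : T, ∀ a : A, ∃ b ∈ At t, a ≤ b)
    -- each `At t` is `τ`-closed in `A`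
    (hclosed : ∀ t : T, ∀ C : Set A, C ⊆ At t → C.Nonempty → IsChain (· ≤ ·) C →
      Cardinal.mk C ≤ τ → ∀ s : A, IsLUB C s → s ∈ At t) :
    -- the intersection is cofinal in `A` ...
    (∀ a : A, ∃ b ∈ ⋂ t : T, At t, a ≤ b) ∧
    -- ... and `τ`-closed in `A`
    (∀ C : Set A, C ⊆ (⋂ t : T, At t) → C.Nonempty → IsChain (· ≤ ·) C →
      Cardinal.mk C ≤ τ → ∀ s : A, IsLUB C s → s ∈ ⋂ t : T, At t) := by
  constructor
  · intro a
    have : Nonempty A := ⟨a⟩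
    choose b hb hab using hcof
    have step : ∀ x : A, ∃ y, x ≤ y ∧ ∀ t, b t x ≤ y := by
      intro x
      obtain ⟨u, hu⟩ :=
        exists_forall_le_of_chain_complete τ hdir hcomplete hT fun t => b t x
      obtain ⟨y, hxy, huy⟩ := hdir x u
      exact ⟨y, hxy, fun t => (hu t).trans huy⟩
    choose next hle hnext using step
    let x : ℕ → A := fun n => next^[n] a
    have hx : ∀ n, x (n + 1) = next (x n) := fun n => Function.iterate_succ_apply' next n a
    have hcard : ∀ y : ℕ → A, Cardinal.mk (Set.range y) ≤ τ := fun y =>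
      (Cardinal.mk_le_aleph0_iff.2 (Set.countable_range y).to_subtype).trans hτ
    have hmono : Monotone x := monotone_nat_of_le_succ fun n => by
      rw [hx]; exact hle _
    obtain ⟨s, hs⟩ := hcomplete (Set.range x) (Set.range_nonempty x) hmono.isChain_range (hcard x)
    refine ⟨s, Set.mem_iInter.2 fun t => ?_, hs.1 ⟨0, rfl⟩⟩
    have hbx : ∀ n, b t (x n) ≤ x (n + 1) := fun n => by
      rw [hx]; exact hnext _ t
    have hbmono : Monotone fun n => b t (x n) :=
      monotone_nat_of_le_succ fun n => (hbx n).trans (hab t _)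
    refine hclosed t (Set.range fun n => b t (x n)) ?_ (Set.range_nonempty _)
      hbmono.isChain_range (hcard _) s ⟨?_, fun u hu => hs.2 ?_⟩
    · rintro _ ⟨n, rfl⟩
      exact hb t _
    · rintro _ ⟨n, rfl⟩
      exact (hbx n).trans (hs.1 ⟨n + 1, rfl⟩)
    · rintro _ ⟨n, rfl⟩
      exact (hab t _).trans (hu ⟨n, rfl⟩)
  · intro C hC hne hchain hcard s hs
    exact Set.mem_iInter.2 fun t =>
      hclosed t C (fun c hc => Set.mem_iInter.1 (hC hc) t) hne hchain hcard s hs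
end

section
/- Let τ be an infinite cardinal, let A be a directed partially ordered set that is τ-complete, and let L ⊆ A × A be a relation satisfying: (Existence) for each α ∈ A there exists β ∈ A with (α, β) ∈ L; (Majorantness) if (α, β) ∈ L and γ ≥ β then (α, γ) ∈ L; (τ-closeness) for every nonempty chain {α_t : t ∈ T} in A with |T| ≤ τ, if there is β ∈ A with (α_t, β) ∈ L for every t ∈ T, then (α, β) ∈ L where α = sup{α_t : t ∈ T}. Then the set of all L-reflexive elements of A (elements α with (α, α) ∈ L) is cofinal and τ-closed in A. -/
universe u

/-- Let `τ` be an infinite cardinal, `A` a directed `τ`-complete partially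
ordered set, and `L ⊆ A × A` a relation satisfying Existence, Majorantness and
`τ`-closeness.  Then the set of `L`-reflexive elements of `A` is cofinal and `τ`-closed
in `A`. -/
theorem statement2 {A : Type u} [PartialOrder A] (τ : Cardinal.{u})
    (hτ : Cardinal.aleph0 ≤ τ)
    -- `A` is directed
    (hdir : ∀ a b : A, ∃ c : A, a ≤ c ∧ b ≤ c)
    -- `A` is `τ`-complete: every nonempty chain of cardinality `≤ τ` has a supremum
    (hcomplete : ∀ C : Set A, C.Nonempty → IsChain (· ≤ ·) C →
      Cardinal.mk C ≤ τ → ∃ s : A, IsLUB C s)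
    (L : Set (A × A))
    -- Existence
    (hex : ∀ α : A, ∃ β : A, (α, β) ∈ L)
    -- Majorantness
    (hmaj : ∀ α β γ : A, (α, β) ∈ L → β ≤ γ → (α, γ) ∈ L)
    -- `τ`-closeness
    (hcl : ∀ C : Set A, C.Nonempty → IsChain (· ≤ ·) C → Cardinal.mk C ≤ τ →
      ∀ β : A, (∀ c ∈ C, (c, β) ∈ L) → ∀ α : A, IsLUB C α → (α, β) ∈ L) :
    -- the set of `L`-reflexive elements is cofinal in `A` ...
    (∀ a : A, ∃ b ∈ {α : A | (α, α) ∈ L}, a ≤ b) ∧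
    -- ... and `τ`-closed in `A`
    (∀ C : Set A, C ⊆ {α : A | (α, α) ∈ L} → C.Nonempty → IsChain (· ≤ ·) C →
      Cardinal.mk C ≤ τ → ∀ s : A, IsLUB C s → s ∈ {α : A | (α, α) ∈ L}) := by
  refine ⟨fun a => ?_, fun C hCL hne hch hcard s hs =>
    hcl C hne hch hcard s (fun c hc => hmaj c c s (hCL hc) (hs.1 hc)) s hs⟩
  have hstep : ∀ x : A, ∃ y : A, x ≤ y ∧ (x, y) ∈ L := fun x => by
    obtain ⟨β, hβ⟩ := hex x
    obtain ⟨y, hxy, hβy⟩ := hdir x β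
    exact ⟨y, hxy, hmaj x β y hβ hβy⟩
  choose f hle hfL using hstep
  let u : ℕ → A := fun n => f^[n] a
  have hsucc : ∀ n, u (n + 1) = f (u n) := fun n => Function.iterate_succ_apply' f n a
  have hmono : Monotone u := monotone_nat_of_le_succ fun n => (hsucc n).symm ▸ hle (u n)
  have hchain : IsChain (· ≤ ·) (Set.range u) := hmono.isChain_range
  have hcard : Cardinal.mk (Set.range u) ≤ τ :=
    (Cardinal.le_aleph0_iff_set_countable.2 (Set.countable_range u)).trans hτ
  obtain ⟨s, hs⟩ := hcomplete _ (Set.range_nonempty u) hchain hcard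
  refine ⟨s, hcl _ (Set.range_nonempty u) hchain hcard s ?_ s hs, hs.1 ⟨0, rfl⟩⟩
  rintro _ ⟨n, rfl⟩
  exact hmaj _ _ s (hfL (u n)) (hs.1 ⟨n + 1, hsucc n⟩)
end
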